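/- Let D = A₁(ℂ) be the first Weyl algebra with its ℤ-grading. The module D/Dt is a simple left D-module, and every graded left D-module that is simple as a D-module and is S-torsion (every element is annihilated by t^n for some n ≥ 1) is isomorphic, as a graded module, to a twist of D/Dt. -/

import Mathlib

set_option synthInstance.maxHeartbeats 1000000
set_option maxHeartbeats 1000000

noncomputable section
open Polynomial

/-- The polynomial ring `ℂ[t]`. -/
abbrev PCc := Polynomial ℂ

/-- Multiplication by `t` as a `ℂ`-linear endomorphism of `ℂ[t]`. -/
def tW : Module.End ℂ PCc := LinearMap.mulLeft ℂ (X : PCc)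

/-- The derivative `∂ = d/dt` as a `ℂ`-linear endomorphism of `ℂ[t]`. -/
def dW : Module.End ℂ PCc := Polynomial.derivative

/-- The first Weyl algebra `A₁(ℂ)`: the ring of `ℂ`-linear differential operators on
`ℂ[t]`, i.e. the `ℂ`-subalgebra of endomorphisms of `ℂ[t]` generated by multiplication
by `t` and the derivative `∂`. -/
def Weyl : Subalgebra ℂ (Module.End ℂ PCc) := Algebra.adjoin ℂ {tW, dW}

/-- The first Weyl algebra, as a type. -/
abbrev Wr : Type := ↥Weyl

noncomputable instance (priority := 5000) instWrRing : Ring Wr := inferInstance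
noncomputable instance (priority := 5000) instWrSemiring : Semiring Wr := instWrRing.toSemiring

/-- `t` as an element of the Weyl algebra. -/
def tWe : Wr := ⟨tW, Algebra.subset_adjoin (by simp)⟩

/-- `∂` as an element of the Weyl algebra. -/
def dWe : Wr := ⟨dW, Algebra.subset_adjoin (by simp)⟩

/-- The Euler operator `E = t∂` as an element of the Weyl algebra. -/
def EWe : Wr := tWe * dWe

/-- An endomorphism of `ℂ[t]` is homogeneous of degree `w` if it maps the homogeneous
component spanned by `t^i` into the one spanned by `t^(i+w)` for all `i` (where the
latter is `0` if `i + w < 0`); thus `t^n ∂^m` is homogeneous of degree `n - m`. -/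
def WIsHomog (w : ℤ) (P : Module.End ℂ PCc) : Prop :=
  ∀ i : ℕ, ∃ c : ℂ,
    P (X ^ i) = c • (if 0 ≤ (i : ℤ) + w then (X : PCc) ^ ((i : ℤ) + w).toNat else 0)

/-- The homogeneous component of degree `w` of the Weyl algebra. -/
def Wgr (w : ℤ) : AddSubgroup Wr where
  carrier := {P | WIsHomog w (P : Module.End ℂ PCc)}
  zero_mem' := fun i => ⟨0, by simp⟩
  add_mem' := by
    rintro P Q hP hQ i
    obtain ⟨c, hc⟩ := hP i
    obtain ⟨d, hd⟩ := hQ i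
    exact ⟨c + d, by
      show ((P : Module.End ℂ PCc) + Q) (X ^ i) = _
      rw [LinearMap.add_apply, hc, hd, add_smul]⟩
  neg_mem' := by
    rintro P hP i
    obtain ⟨c, hc⟩ := hP i
    exact ⟨-c, by
      show (-(P : Module.End ℂ PCc)) (X ^ i) = _
      rw [LinearMap.neg_apply, hc, neg_smul]⟩

/-- `J* = {α ∈ ℂ : 0 ≤ Re α < 1, α ≠ 0}`. -/
def Jstar : Set ℂ := {α : ℂ | 0 ≤ α.re ∧ α.re < 1 ∧ α ≠ 0}

/-- The quotient of the Weyl algebra by the left ideal generated by `P`,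
as a left module. -/
abbrev WQuot (P : Wr) : Type := Wr ⧸ (Ideal.span {P} : Ideal Wr)

/-- The induced grading on a quotient of the Weyl algebra by a (homogeneous) left
ideal: the component of degree `w` is the image of the component of degree `w` of
the Weyl algebra. -/
def WQgr (P : Wr) (w : ℤ) : AddSubgroup (WQuot P) :=
  AddSubgroup.map (Ideal.span {P} : Ideal Wr).mkQ.toAddMonoidHom (Wgr w)

/-- Two graded modules are isomorphic up to a twist if there is a module isomorphism
`e : M ≃ N` and an integer `n` with `e(Mᵢ) = N_{n+i}` for all `i`, i.e. `M ≅ N[n]`. -/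
def WGrIsoTw (M N : Type) [AddCommGroup M] [Module Wr M] [AddCommGroup N] [Module Wr N]
    (ℳ : ℤ → AddSubgroup M) (𝒩 : ℤ → AddSubgroup N) : Prop :=
  ∃ (n : ℤ) (e : M ≃ₗ[Wr] N), ∀ i : ℤ, (fun x => e x) '' (ℳ i : Set M) = (𝒩 (n + i) : Set N)

theorem aux_comm_End : dW * tW = tW * dW + 1 := by
  apply LinearMap.ext
  intro p
  rw [LinearMap.add_apply, Module.End.mul_apply, Module.End.mul_apply, Module.End.one_apply]
  simp only [dW, tW, LinearMap.mulLeft_apply]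
  rw [derivative_mul, derivative_X, one_mul, add_comm]

theorem aux_comm : dWe * tWe = tWe * dWe + 1 :=
  Subtype.ext aux_comm_End

theorem aux_comm_pow {A : Type} [Ring A] (t d : A) (hc : d * t = t * d + 1) (n : ℕ) :
    t * d ^ n = d ^ n * t - (n : A) * d ^ (n - 1) := by
  induction n with
  | zero => simp
  | succ n ih =>
    have h1 : t * d = d * t - 1 := by rw [hc]; abel
    rw [pow_succ', ← mul_assoc, h1, sub_mul, mul_assoc, ih, mul_sub, one_mul, ← mul_assoc,
      ← mul_assoc, ← Nat.cast_comm n d, mul_assoc (n : A)]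
    rcases n with _ | n
    · simp
    · rw [Nat.add_sub_cancel, Nat.add_sub_cancel, ← pow_succ' d n]
      push_cast
      simp only [add_mul, one_mul]
      abel

theorem aux_comm_aeval_gen {A : Type} [Ring A] [Algebra ℂ A] (t d : A) (hc : d * t = t * d + 1)
    (q : ℂ[X]) : t * aeval d q = aeval d q * t - aeval d (derivative q) := by
  induction q using Polynomial.induction_on' with
  | add p q hp hq =>
    simp only [map_add, mul_add, add_mul, hp, hq]
    abel
  | monomial n a =>
    rw [derivative_monomial, aeval_monomial, aeval_monomial, ← mul_assoc,
      ← Algebra.commutes a t, mul_assoc, aux_comm_pow t d hc, mul_sub, mul_assoc]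
    simp [mul_assoc]

theorem aux_comm_aeval (q : ℂ[X]) :
    tWe * aeval dWe q = aeval dWe q * tWe - aeval dWe (derivative q) :=
  aux_comm_aeval_gen tWe dWe aux_comm q

/-- closure of a predicate under Weyl operators -/
theorem aux_induct {C : Wr → Prop} (hc : ∀ c : ℂ, C (algebraMap ℂ Wr c)) (ht : C tWe) (hd : C dWe)
    (hadd : ∀ P Q, C P → C Q → C (P + Q)) (hmul : ∀ P Q, C P → C Q → C (P * Q)) (P : Wr) : C P := by
  obtain ⟨P, hP⟩ := P
  refine Algebra.adjoin_induction (p := fun x hx => C ⟨x, hx⟩) ?_ ?_ ?_ ?_ hP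
  · intro x hx
    rcases hx with rfl | hx
    · exact ht
    · rcases hx with rfl
      exact hd
  · intro c; exact hc c
  · intro x y hx hy h1 h2; exact hadd _ _ h1 h2
  · intro x y hx hy h1 h2; exact hmul _ _ h1 h2

section
variable {M : Type} [AddCommGroup M] [Module Wr M]

theorem aux_t_smul (v : M) (hv : tWe • v = 0) (q : ℂ[X]) :
    tWe • (aeval dWe q • v) = -(aeval dWe (derivative q) • v) := by
  rw [← mul_smul, aux_comm_aeval, sub_smul, mul_smul, hv, smul_zero, zero_sub]

theorem aux_span (v : M) (hv : tWe • v = 0) (P : Wr) : ∃ p : ℂ[X], P • v = aeval dWe p • v := by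
  suffices h : ∀ q : ℂ[X], ∃ p : ℂ[X], P • (aeval dWe q • v) = aeval dWe p • v by
    obtain ⟨p, hp⟩ := h 1
    exact ⟨p, by simpa using hp⟩
  induction P using aux_induct with
  | hc c => exact fun q => ⟨C c * q, by rw [map_mul, aeval_C, mul_smul]⟩
  | ht => exact fun q => ⟨-derivative q, by rw [aux_t_smul v hv, map_neg, neg_smul]⟩
  | hd => exact fun q => ⟨X * q, by rw [map_mul, aeval_X, mul_smul]⟩
  | hadd P Q hP hQ =>
    intro q
    obtain ⟨p1, h1⟩ := hP q
    obtain ⟨p2, h2⟩ := hQ q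
    exact ⟨p1 + p2, by rw [add_smul, h1, h2, map_add, add_smul]⟩
  | hmul P Q hP hQ =>
    intro q
    obtain ⟨p2, h2⟩ := hQ q
    obtain ⟨p1, h1⟩ := hP p2
    exact ⟨p1, by rw [mul_smul, h2, h1]⟩

theorem aux_mem (v : M) (hv : tWe • v = 0) (N : Submodule Wr M) :
    ∀ (n : ℕ) (p : ℂ[X]), p.natDegree = n → p ≠ 0 → aeval dWe p • v ∈ N → v ∈ N := by
  intro n
  induction n with
  | zero =>
    intro p hn h0 hp
    obtain ⟨c, rfl⟩ := natDegree_eq_zero.1 hn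
    have hc : c ≠ 0 := by rintro rfl; simp at h0
    have := N.smul_mem (algebraMap ℂ Wr c⁻¹) hp
    rwa [aeval_C, ← mul_smul, ← map_mul, inv_mul_cancel₀ hc, map_one, one_smul] at this
  | succ n ih =>
    intro p hn h0 hp
    have hd : (derivative p).natDegree = n := by
      rw [natDegree_derivative, hn]; rfl
    refine ih _ hd ?_ ?_
    · intro h
      have := natDegree_eq_zero_of_derivative_eq_zero h
      omega
    · have := N.smul_mem tWe hp
      rw [aux_t_smul v hv] at this
      simpa using this

theorem aux_simple (v : M) (hv : tWe • v = 0) (h0 : v ≠ 0) (hgen : ∀ x : M, ∃ P : Wr, P • v = x) :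
    IsSimpleModule Wr M := by
  haveI : Nontrivial M := ⟨v, 0, h0⟩
  rw [isSimpleModule_iff]
  refine { eq_bot_or_eq_top := fun N => ?_ }
  by_cases hN : N = ⊥
  · exact Or.inl hN
  right
  obtain ⟨x, hx, hx0⟩ := N.ne_bot_iff.1 hN
  obtain ⟨P, rfl⟩ := hgen x
  obtain ⟨p, hp⟩ := aux_span v hv P
  rw [hp] at hx hx0
  have hvN : v ∈ N := aux_mem v hv N _ p rfl (by rintro rfl; simp at hx0) hx
  rw [eq_top_iff]
  rintro y -
  obtain ⟨Q, rfl⟩ := hgen y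
  exact N.smul_mem Q hvN

end

/-- coefficient extended to integer indices -/
def cfZ (p : ℂ[X]) (z : ℤ) : ℂ := if 0 ≤ z then p.coeff z.toNat else 0

theorem cfZ_X_mul (p : ℂ[X]) (z : ℤ) : cfZ (X * p) z = cfZ p (z - 1) := by
  unfold cfZ
  rcases lt_trichotomy z 0 with h | h | h
  · rw [if_neg (by omega), if_neg (by omega)]
  · subst h; simp
  · obtain ⟨n, rfl⟩ : ∃ n : ℕ, z = n + 1 := ⟨(z - 1).toNat, by omega⟩
    rw [if_pos (by omega), if_pos (by omega), show ((n : ℤ) + 1).toNat = n + 1 by omega,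
      show ((n : ℤ) + 1 - 1).toNat = n by omega, coeff_X_mul]

theorem cfZ_derivative (p : ℂ[X]) (z : ℤ) :
    cfZ (derivative p) z = ((z : ℂ) + 1) * cfZ p (z + 1) := by
  unfold cfZ
  rcases lt_or_ge z 0 with h | h
  · rw [if_neg (by omega)]
    rcases eq_or_ne z (-1) with h1 | h1
    · subst h1; simp
    · rw [if_neg (by omega), mul_zero]
  · obtain ⟨n, rfl⟩ := Int.eq_ofNat_of_zero_le h
    rw [if_pos (by omega), if_pos (by omega), show ((n : ℤ)).toNat = n by omega,
      show ((n : ℤ) + 1).toNat = n + 1 by omega, coeff_derivative, mul_comm]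
    simp

def PolyInv (A : Wr) : Prop :=
  ∀ w : ℤ, ∃ g : ℂ[X], ∀ n : ℕ, cfZ ((A : Module.End ℂ PCc) (X ^ n)) (n + w) = g.eval (n : ℂ)

theorem aux_polyInv (P : Wr) : PolyInv P := by
  suffices h : ∀ A, PolyInv A → PolyInv (P * A) by
    have h1 : PolyInv 1 := by
      intro w
      rcases eq_or_ne w 0 with rfl | hw
      · refine ⟨1, fun n => ?_⟩
        show cfZ (X ^ n) _ = _
        simp [cfZ]
      · refine ⟨0, fun n => ?_⟩
        show cfZ (X ^ n) _ = _
        unfold cfZ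
        split_ifs with h
        · rw [coeff_X_pow, if_neg (by omega)]; simp
        · simp
    simpa using h 1 h1
  induction P using aux_induct with
  | hc c =>
    intro A hA w
    obtain ⟨g, hg⟩ := hA w
    refine ⟨C c * g, fun n => ?_⟩
    show cfZ (c • ((A : Module.End ℂ PCc) (X ^ n))) _ = _
    rw [eval_mul, eval_C, ← hg]
    unfold cfZ
    split_ifs <;> simp
  | ht =>
    intro A hA w
    obtain ⟨g, hg⟩ := hA (w - 1)
    refine ⟨g, fun n => ?_⟩
    show cfZ (X * ((A : Module.End ℂ PCc) (X ^ n))) _ = _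
    rw [cfZ_X_mul, ← hg, add_sub_assoc]
  | hd =>
    intro A hA w
    obtain ⟨g, hg⟩ := hA (w + 1)
    refine ⟨(X + C ((w : ℂ) + 1)) * g, fun n => ?_⟩
    show cfZ (derivative ((A : Module.End ℂ PCc) (X ^ n))) _ = _
    rw [cfZ_derivative, add_assoc (n : ℤ), hg]
    simp
    ring_nf
    simp
  | hadd P Q hP hQ =>
    intro A hA w
    obtain ⟨g, hg⟩ := hP A hA w
    obtain ⟨g', hg'⟩ := hQ A hA w
    refine ⟨g + g', fun n => ?_⟩
    rw [eval_add, ← hg, ← hg', add_mul]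
    show cfZ (((P * A : Wr) : Module.End ℂ PCc) (X ^ n) + ((Q * A : Wr) : Module.End ℂ PCc) (X ^ n)) _ = _
    unfold cfZ
    split_ifs <;> simp
  | hmul P Q hP hQ =>
    intro A hA
    rw [mul_assoc]
    exact hP _ (hQ _ hA)

theorem aux_one_notMem : (1 : Wr) ∉ (Ideal.span {tWe} : Ideal Wr) := by
  intro h
  obtain ⟨Q, hQ⟩ := Ideal.mem_span_singleton'.1 h
  have hQ1 : ∀ p : ℂ[X], (Q : Module.End ℂ PCc) (X * p) = p := by
    intro p
    have := congrArg (fun A : Wr => (A : Module.End ℂ PCc) p) hQ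
    exact this
  obtain ⟨g, hg⟩ := aux_polyInv Q (-1)
  have h1 : ∀ n : ℕ, g.eval ((n : ℂ) + 1) = 1 := by
    intro n
    have := hg (n + 1)
    rw [pow_succ', hQ1] at this
    push_cast at this
    rw [← this]
    simp [cfZ]
  have h0 : g.eval 0 = 0 := by
    have := hg 0
    simpa [cfZ] using this.symm
  have : g = 1 := by
    refine Polynomial.eq_of_infinite_eval_eq _ _ ?_
    refine Set.Infinite.mono (s := Set.range (fun n : ℕ => (n : ℂ) + 1)) ?_ ?_
    · rintro _ ⟨n, rfl⟩
      simp [h1]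
    · refine Set.infinite_range_of_injective ?_
      intro a b hab
      simpa using hab
  rw [this] at h0
  simp at h0

theorem aux_quot_simple : IsSimpleModule Wr (WQuot tWe) := by
  refine aux_simple (Submodule.Quotient.mk (1 : Wr)) ?_ ?_ ?_
  · rw [← Submodule.Quotient.mk_smul, Submodule.Quotient.mk_eq_zero, smul_eq_mul, mul_one]
    exact Ideal.mem_span_singleton_self _
  · rw [Ne, Submodule.Quotient.mk_eq_zero]
    exact aux_one_notMem
  · intro x
    obtain ⟨P, rfl⟩ := Submodule.Quotient.mk_surjective _ x
    exact ⟨P, by rw [← Submodule.Quotient.mk_smul, smul_eq_mul, mul_one]⟩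

theorem aux_t_mem : tWe ∈ Wgr 1 := by
  intro i
  refine ⟨1, ?_⟩
  show X * X ^ i = _
  rw [if_pos (by omega), one_smul, show ((i : ℤ) + 1).toNat = i + 1 by omega, pow_succ']

theorem aux_d_mem (c : ℂ) (k : ℕ) : algebraMap ℂ Wr c * dWe ^ k ∈ Wgr (-(k : ℤ)) := by
  intro i
  refine ⟨c * (i.descFactorial k : ℂ), ?_⟩
  have h : ((algebraMap ℂ Wr c * dWe ^ k : Wr) : Module.End ℂ PCc) (X ^ i)
      = c • (derivative^[k] (X ^ i : ℂ[X])) := by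
    show c • ((dW ^ k) (X ^ i)) = _
    rw [Module.End.pow_apply]
    rfl
  rw [h, iterate_derivative_X_pow_eq_smul]
  split_ifs with hk
  · rw [show ((i : ℤ) + -(k : ℤ)).toNat = i - k by omega, mul_smul]
  · rw [Nat.descFactorial_of_lt (by omega), Nat.cast_zero, zero_smul, smul_zero, smul_zero]

/-- `D/Dt` is a simple left module over the Weyl algebra `D = A₁(ℂ)`,
and every graded left `D`-module which is simple as a `D`-module and is `S`-torsion
(every element is annihilated by a power `t^n`, `n ≥ 1`) is graded isomorphic to a
twist of `D/Dt`. -/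
theorem stmt_16 :
    IsSimpleModule Wr (WQuot tWe) ∧
    (∀ (M : Type) [AddCommGroup M] [Module Wr M] (ℳ : ℤ → AddSubgroup M)
      [DirectSum.Decomposition ℳ] [SetLike.GradedSMul Wgr ℳ],
      IsSimpleModule Wr M → (∀ m : M, ∃ n : ℕ, 1 ≤ n ∧ (tWe ^ n) • m = 0) →
      WGrIsoTw M (WQuot tWe) ℳ (WQgr tWe)) := by
  refine ⟨aux_quot_simple, ?_⟩
  intro M _ _ ℳ _ _ hM htor
  haveI := hM
  haveI := aux_quot_simple
  -- a homogeneous nonzero element killed by t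
  obtain ⟨k, m0, hm0, hne, htm⟩ : ∃ (k : ℤ) (m0 : M), m0 ∈ ℳ k ∧ m0 ≠ 0 ∧ tWe • m0 = 0 := by
    haveI := IsSimpleModule.nontrivial Wr M
    obtain ⟨m, hm⟩ := exists_ne (0 : M)
    obtain ⟨k, hk⟩ : ∃ k, (DirectSum.decompose ℳ m k : M) ≠ 0 := by
      by_contra hcon
      push Not at hcon
      apply hm
      apply (DirectSum.decompose ℳ).injective
      rw [DirectSum.decompose_zero]
      refine DFinsupp.ext fun i => Subtype.ext ?_
      exact hcon i
    have hind : ∀ (n : ℕ) (k : ℤ) (x : M), x ∈ ℳ k → x ≠ 0 → (tWe ^ n) • x = 0 →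
        ∃ (k : ℤ) (m0 : M), m0 ∈ ℳ k ∧ m0 ≠ 0 ∧ tWe • m0 = 0 := by
      intro n
      induction n with
      | zero => intro k x _ h0 h1; simp at h1; exact absurd h1 h0
      | succ n ih =>
        intro k x hx h0 h1
        by_cases h : tWe • x = 0
        · exact ⟨k, x, hx, h0, h⟩
        · refine ih (1 + k) (tWe • x) (SetLike.GradedSMul.smul_mem aux_t_mem hx) h ?_
          rw [← mul_smul, ← pow_succ, h1]
    obtain ⟨n, _, hn⟩ := htor (DirectSum.decompose ℳ m k : M)
    exact hind n k _ (SetLike.coe_mem _) hk hn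
  let f0 : Wr →ₗ[Wr] M := LinearMap.toSpanSingleton Wr M m0
  have hf0 : (Ideal.span {tWe} : Ideal Wr) ≤ LinearMap.ker f0 := by
    rw [Ideal.span_le, Set.singleton_subset_iff]
    exact htm
  let f : WQuot tWe →ₗ[Wr] M := Submodule.liftQ _ f0 hf0
  have hf : ∀ P : Wr, f (Submodule.Quotient.mk P) = P • m0 := fun P => rfl
  have hfne : f ≠ 0 := by
    intro h
    have := hf 1
    rw [h, one_smul] at this
    exact hne this.symm
  have hbij : Function.Bijective f := LinearMap.bijective_of_ne_zero hfne
  let e := LinearEquiv.ofBijective f hbij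
  have he : ∀ y, e.symm (f y) = y := fun y => e.symm_apply_apply y
  refine ⟨-k, e.symm, fun i => ?_⟩
  ext y
  constructor
  · rintro ⟨x, hx, rfl⟩
    obtain ⟨y, rfl⟩ := hbij.2 x
    obtain ⟨P, rfl⟩ := Submodule.Quotient.mk_surjective _ y
    show e.symm (f _) ∈ WQgr tWe (-k + i)
    rw [hf] at hx
    obtain ⟨p, hp⟩ := aux_span m0 htm P
    -- the homogeneous component of degree i
    have hcomp : ∃ Q ∈ Wgr (-k + i), P • m0 = Q • m0 := by
      have hx' : ((DirectSum.decompose ℳ (P • m0) i : ℳ i) : M) = P • m0 :=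
        DirectSum.decompose_of_mem_same ℳ hx
      rw [hp] at hx'
      rw [hp, ← hx']
      clear hx hp hx'
      induction p using Polynomial.induction_on' with
      | add p q h1 h2 =>
        obtain ⟨Q1, hQ1, h1⟩ := h1
        obtain ⟨Q2, hQ2, h2⟩ := h2
        refine ⟨Q1 + Q2, add_mem hQ1 hQ2, ?_⟩
        rw [add_smul, ← h1, ← h2, map_add, add_smul, DirectSum.decompose_add]
        rfl
      | monomial n a =>
        rw [aeval_monomial]
        have hmem : (algebraMap ℂ Wr a * dWe ^ n) • m0 ∈ ℳ (-(n : ℤ) + k) :=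
          SetLike.GradedSMul.smul_mem (aux_d_mem a n) hm0
        by_cases hi : -(n : ℤ) + k = i
        · refine ⟨algebraMap ℂ Wr a * dWe ^ n, ?_, ?_⟩
          · have := aux_d_mem a n
            rwa [show -(n : ℤ) = -k + i by omega] at this
          · rw [hi] at hmem
            exact DirectSum.decompose_of_mem_same ℳ hmem
        · refine ⟨0, zero_mem _, ?_⟩
          rw [zero_smul]
          exact DirectSum.decompose_of_mem_ne ℳ hmem hi
    obtain ⟨Q, hQ, hPQ⟩ := hcomp
    refine ⟨Q, hQ, ?_⟩
    rw [hf, hPQ, ← hf, he]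
    rfl
  · rintro ⟨Q, hQ, rfl⟩
    refine ⟨Q • m0, ?_, ?_⟩
    · have := SetLike.GradedSMul.smul_mem (A := Wgr) (B := ℳ) hQ hm0
      rw [show (-k + i) +ᵥ k = i by show (-k + i) + k = i; omega] at this
      exact this
    · show e.symm (Q • m0) = _
      rw [← hf, he]
      rfl
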